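/- arXiv:2510.23335 — 2 statements merged into one kernel-verified Lean document; each statement's English description precedes it below -/
import Mathlib

section
/- Let S be a finite nonempty set, P an irreducible row-stochastic matrix on S with invariant distribution μ₀, and Q : S × S → ℝ a matrix with Σ_{s'} Q(s,s') = 0 for all s and Q(s,s') ≥ 0 whenever P(s,s') = 0. Let r, r₁ : S → ℝ. Then there exist constants C > 0 and ε₀ > 0 such that for all ε with 0 ≤ ε < ε₀, the matrix P + εQ is row-stochastic, and every invariant distribution μ_ε of P + εQ satisfies | Σ_s μ_ε(s)(r(s) + ε r₁(s)) − Σ_s μ₀(s) r(s) | ≤ C·ε. -/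
open Finset

/-- A row-stochastic matrix on a finite set `S`. -/
def RowStochastic {S : Type} [Fintype S] (P : Matrix S S ℝ) : Prop :=
  (∀ s s', 0 ≤ P s s') ∧ ∀ s, ∑ s', P s s' = 1

/-- Irreducibility: for all `s, s'` there is `n ≥ 1` with `(P^n) s s' > 0`. -/
def IrreducibleMat {S : Type} [Fintype S] [DecidableEq S] (P : Matrix S S ℝ) : Prop :=
  ∀ s s', ∃ n : ℕ, 1 ≤ n ∧ 0 < (P ^ n) s s'

/-- `μ` is an invariant (stationary) probability distribution of `P`. -/
def InvariantDist {S : Type} [Fintype S] (μ : S → ℝ) (P : Matrix S S ℝ) : Prop :=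
  (∀ s, 0 ≤ μ s) ∧ (∑ s, μ s = 1) ∧ ∀ s', ∑ s, μ s * P s s' = μ s'

open Finset in
theorem aux_harmonic_const {S : Type} [Fintype S] [DecidableEq S] [Nonempty S]
    (P : Matrix S S ℝ) (hP : RowStochastic P) (hirr : IrreducibleMat P)
    (h : S → ℝ) (hh : P.mulVec h = h) : ∃ c, ∀ s, h s = c := by
  obtain ⟨s0, hs0⟩ := Finite.exists_max h
  refine ⟨h s0, fun s => ?_⟩
  have one : P.mulVec (fun _ => (1:ℝ)) = fun _ => 1 := by
    funext x
    simp [Matrix.mulVec, dotProduct, hP.2]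
  have pow_fix : ∀ (v : S → ℝ), P.mulVec v = v → ∀ n : ℕ, (P ^ n).mulVec v = v := by
    intro v hv n
    induction n with
    | zero => simp
    | succ k ih => rw [pow_succ, ← Matrix.mulVec_mulVec, hv, ih]
  have pow_nonneg' : ∀ n : ℕ, ∀ a b, 0 ≤ (P ^ n) a b := by
    intro n
    induction n with
    | zero => intro a b; simp only [pow_zero, Matrix.one_apply]; split_ifs <;> norm_num
    | succ k ih =>
      intro a b
      rw [pow_succ, Matrix.mul_apply]
      exact Finset.sum_nonneg fun x _ => mul_nonneg (ih _ _) (hP.1 _ _)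
  obtain ⟨n, -, hn⟩ := hirr s0 s
  have e1 := congrFun (pow_fix h hh n) s0
  have e2 := congrFun (pow_fix _ one n) s0
  simp only [Matrix.mulVec, dotProduct, mul_one] at e1 e2
  have e3 : ∑ x, (P ^ n) s0 x * (h s0 - h x) = 0 := by
    simp only [mul_sub, Finset.sum_sub_distrib, ← Finset.sum_mul, e1, e2]; ring
  rw [Finset.sum_eq_zero_iff_of_nonneg
    (fun x _ => mul_nonneg (pow_nonneg' n _ _) (sub_nonneg.2 (hs0 x)))] at e3
  rcases mul_eq_zero.1 (e3 s (Finset.mem_univ _)) with h1 | h1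
  · exact absurd h1 hn.ne'
  · linarith

theorem aux_invariant_sum {S : Type} [Fintype S]
    (P : Matrix S S ℝ) (μ : S → ℝ) (hinv : InvariantDist μ P) (h : S → ℝ) :
    ∑ s, μ s * (P.mulVec h) s = ∑ s, μ s * h s := by
  simp only [Matrix.mulVec, dotProduct, Finset.mul_sum]
  rw [Finset.sum_comm]
  refine Finset.sum_congr rfl fun y _ => ?_
  rw [← hinv.2.2 y, Finset.sum_mul]
  exact Finset.sum_congr rfl fun x _ => by ring

theorem aux_poisson {S : Type} [Fintype S] [DecidableEq S] [Nonempty S]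
    (P : Matrix S S ℝ) (μ₀ : S → ℝ)
    (hP : RowStochastic P) (hirr : IrreducibleMat P) (hinv : InvariantDist μ₀ P)
    (r : S → ℝ) : ∃ h : S → ℝ, ∀ s, h s - P.mulVec h s + ∑ x, μ₀ x * r x = r s := by
  let L : (S → ℝ) →ₗ[ℝ] (S → ℝ) :=
    { toFun := fun h s => h s - P.mulVec h s + ∑ x, μ₀ x * h x
      map_add' := by
        intro a b; funext s
        simp only [Matrix.mulVec_add, Pi.add_apply, mul_add, Finset.sum_add_distrib]; ring
      map_smul' := by
        intro c a; funext s
        have : ∑ x, μ₀ x * (c * a x) = c * ∑ x, μ₀ x * a x := by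
          rw [Finset.mul_sum]; exact Finset.sum_congr rfl fun x _ => by ring
        simp only [Matrix.mulVec_smul, Pi.smul_apply, smul_eq_mul, RingHom.id_apply, this]; ring }
  have hL : ∀ h s, L h s = h s - P.mulVec h s + ∑ x, μ₀ x * h x := fun _ _ => rfl
  have hμ : ∀ h, ∑ s, μ₀ s * L h s = ∑ x, μ₀ x * h x := by
    intro h
    simp only [hL, mul_add, mul_sub, Finset.sum_add_distrib, Finset.sum_sub_distrib,
      ← Finset.sum_mul, aux_invariant_sum P μ₀ hinv h, hinv.2.1]
    ring
  have inj : Function.Injective L := by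
    rw [injective_iff_map_eq_zero]
    intro h h0
    have m0 := hμ h
    rw [h0] at m0
    simp only [Pi.zero_apply, mul_zero, Finset.sum_const_zero] at m0
    have hh : P.mulVec h = h := by
      funext s
      have := hL h s
      rw [h0, ← m0] at this
      simp only [Pi.zero_apply] at this
      linarith
    obtain ⟨c, hc⟩ := aux_harmonic_const P hP hirr h hh
    simp only [hc, ← Finset.sum_mul, hinv.2.1, one_mul] at m0
    funext s
    rw [hc, ← m0]; rfl
  obtain ⟨h, hh⟩ := (LinearMap.injective_iff_surjective.1 inj) r
  refine ⟨h, fun s => ?_⟩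
  have := hμ h
  rw [hh] at this
  rw [this, ← hL, hh]

theorem aux_nonneg {S : Type} [Fintype S]
    (P Q : Matrix S S ℝ) (hP : RowStochastic P) (hQpos : ∀ s s', P s s' = 0 → 0 ≤ Q s s') :
    ∃ ε₀ > (0 : ℝ), ∀ ε : ℝ, 0 ≤ ε → ε < ε₀ → ∀ s s', 0 ≤ P s s' + ε * Q s s' := by
  have key : ∀ᶠ ε in nhdsWithin (0:ℝ) (Set.Ici 0), ∀ s s', 0 ≤ P s s' + ε * Q s s' := by
    rw [Filter.eventually_all]; intro s
    rw [Filter.eventually_all]; intro s'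
    by_cases h : P s s' = 0
    · filter_upwards [self_mem_nhdsWithin] with ε hε
      rw [h, zero_add]
      exact mul_nonneg hε (hQpos _ _ h)
    · have hpos : 0 < P s s' := lt_of_le_of_ne (hP.1 _ _) (Ne.symm h)
      have hc : Continuous fun ε : ℝ => P s s' + ε * Q s s' := by fun_prop
      have := (hc.tendsto 0).eventually (lt_mem_nhds (a := (0:ℝ)) (by simpa using hpos))
      filter_upwards [nhdsWithin_le_nhds this] with ε hε using hε.le
  obtain ⟨u, hu, hsub⟩ := (mem_nhdsGE_iff_exists_Ico_subset).1 key
  exact ⟨u, hu, fun ε h0 h1 => hsub ⟨h0, h1⟩⟩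

theorem aux_avg_bound {S : Type} [Fintype S] (μ f : S → ℝ) (h0 : ∀ s, 0 ≤ μ s)
    (h1 : ∑ s, μ s = 1) : |∑ s, μ s * f s| ≤ ∑ s, |f s| := by
  refine (Finset.abs_sum_le_sum_abs _ _).trans (Finset.sum_le_sum fun s _ => ?_)
  rw [abs_mul, abs_of_nonneg (h0 s)]
  have : μ s ≤ 1 := h1 ▸ Finset.single_le_sum (fun i _ => h0 i) (Finset.mem_univ s)
  exact mul_le_of_le_one_left (abs_nonneg _) this

/-- **First-order perturbation bound for the average reward**: the steady-state
average of the perturbed reward under any invariant distribution of `P + εQ`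
is within `C·ε` of the unperturbed average. -/
theorem average_reward_perturbation_bound
    {S : Type} [Fintype S] [DecidableEq S] [Nonempty S]
    (P Q : Matrix S S ℝ) (μ₀ : S → ℝ)
    (hP : RowStochastic P) (hirr : IrreducibleMat P) (hinv : InvariantDist μ₀ P)
    (hQ0 : ∀ s, ∑ s', Q s s' = 0) (hQpos : ∀ s s', P s s' = 0 → 0 ≤ Q s s')
    (r r₁ : S → ℝ) :
    ∃ C > (0 : ℝ), ∃ ε₀ > (0 : ℝ), ∀ ε : ℝ, 0 ≤ ε → ε < ε₀ →
      RowStochastic (P + ε • Q) ∧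
      ∀ με : S → ℝ, InvariantDist με (P + ε • Q) →
        |(∑ s, με s * (r s + ε * r₁ s)) - ∑ s, μ₀ s * r s| ≤ C * ε := by
  obtain ⟨h, hh⟩ := aux_poisson P μ₀ hP hirr hinv r
  obtain ⟨ε₀, hε₀, hnn⟩ := aux_nonneg P Q hP hQpos
  refine ⟨∑ s, |Q.mulVec h s + r₁ s| + 1, by positivity, ε₀, hε₀, fun ε h0 h1 => ⟨⟨?_, ?_⟩, ?_⟩⟩
  · intro s s'
    simpa using hnn ε h0 h1 s s'
  · intro s
    simp [Finset.sum_add_distrib, ← Finset.mul_sum, hP.2, hQ0]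
  · intro μ hμ
    have e := aux_invariant_sum _ μ hμ h
    have e2 : (∑ s, μ s * (r s + ε * r₁ s)) - ∑ s, μ₀ s * r s
        = ε * ∑ s, μ s * (Q.mulVec h s + r₁ s) := by
      have e3 : ∑ s, μ s * (r s + ε * r₁ s) = (∑ s, μ s * h s
          - ∑ s, μ s * ((P + ε • Q).mulVec h) s)
          + (∑ s, μ s) * (∑ s, μ₀ s * r s) + ε * ∑ s, μ s * (Q.mulVec h s + r₁ s) := by
        rw [Finset.sum_mul, Finset.mul_sum, ← Finset.sum_sub_distrib, ← Finset.sum_add_distrib,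
          ← Finset.sum_add_distrib]
        refine Finset.sum_congr rfl fun s _ => ?_
        simp only [Matrix.add_mulVec, Matrix.smul_mulVec, Pi.add_apply, Pi.smul_apply, smul_eq_mul]
        rw [← hh s]; ring
      rw [e3, e, hμ.2.1]; ring
    rw [e2, abs_mul, abs_of_nonneg h0, mul_comm]
    refine mul_le_mul_of_nonneg_right ?_ h0
    have := aux_avg_bound μ (fun s => Q.mulVec h s + r₁ s) hμ.1 hμ.2.1
    linarith
end

section
/- Consider an ε-perturbed nearly separable MDP in which the unperturbed induced matrix P_π^0 is irreducible for every stationary policy π, with invariant distribution μ_π^0. Then there exist constants C > 0 and ε₀ > 0, uniform over all stationary policies, such that for all ε with 0 ≤ ε < ε₀ and every stationary policy π : S → A, every perturbed matrix P_π^ε is row-stochastic and every invariant distribution μ of P_π^ε satisfies | Σ_s μ(s) r^ε(s, π(s)) − Σ_s μ_π^0(s) (r_S(s) + r_A(π(s))) | ≤ C·ε. -/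
open Finset

lemma aux_pow_nonneg {S : Type} [Fintype S] [DecidableEq S] (P : Matrix S S ℝ)
    (hP : ∀ s s', 0 ≤ P s s') (n : ℕ) : ∀ s s', 0 ≤ (P ^ n) s s' := by
  induction n with
  | zero =>
    intro s s'
    rw [pow_zero, Matrix.one_apply]
    split_ifs <;> norm_num
  | succ k ih =>
    intro s s'
    rw [pow_succ, Matrix.mul_apply]
    exact Finset.sum_nonneg fun j _ => mul_nonneg (ih _ _) (hP _ _)

lemma aux_kernel {S : Type} [Fintype S] [DecidableEq S] (P : Matrix S S ℝ)
    (hP : RowStochastic P) (hirr : IrreducibleMat P) (v : S → ℝ)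
    (hv : ∀ s', ∑ s, v s * P s s' = v s') (hs : ∑ s, v s = 0) : v = 0 := by
  have hle : ∀ s', max (v s') 0 ≤ ∑ s, max (v s) 0 * P s s' := by
    intro s'
    refine max_le ?_ ?_
    · rw [← hv s']
      exact Finset.sum_le_sum fun s _ => mul_le_mul_of_nonneg_right (le_max_left _ _) (hP.1 _ _)
    · exact Finset.sum_nonneg fun s _ => mul_nonneg (le_max_right _ _) (hP.1 _ _)
  have hsum : ∑ s', max (v s') 0 = ∑ s', ∑ s, max (v s) 0 * P s s' := by
    rw [Finset.sum_comm]
    refine Finset.sum_congr rfl fun s _ => ?_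
    rw [← Finset.mul_sum, hP.2, mul_one]
  have heq : ∀ s', max (v s') 0 = ∑ s, max (v s) 0 * P s s' := fun s' =>
    (Finset.sum_eq_sum_iff_of_le (fun i _ => hle i)).1 hsum s' (Finset.mem_univ _)
  have hpow : ∀ n : ℕ, ∀ s', max (v s') 0 = ∑ s, max (v s) 0 * (P ^ n) s s' := by
    intro n
    induction n with
    | zero => intro s'; simp [Matrix.one_apply]
    | succ k ih =>
      intro s'
      rw [heq s']
      simp_rw [pow_succ, Matrix.mul_apply, Finset.mul_sum]
      rw [Finset.sum_comm]
      refine Finset.sum_congr rfl fun s _ => ?_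
      rw [ih s, Finset.sum_mul]
      exact Finset.sum_congr rfl fun j _ => by ring
  have hnonpos : ∀ s, v s ≤ 0 := by
    intro s
    by_contra hpos
    push Not at hpos
    have hall : ∀ s', 0 < v s' := by
      intro s'
      obtain ⟨n, -, hn⟩ := hirr s s'
      have h1 : 0 < max (v s') 0 := by
        rw [hpow n s']
        refine Finset.sum_pos' (fun j _ => mul_nonneg (le_max_right _ _)
          (aux_pow_nonneg P hP.1 n _ _)) ⟨s, Finset.mem_univ _, ?_⟩
        exact mul_pos (lt_max_of_lt_left hpos) hn
      simpa using h1
    have : 0 < ∑ s, v s := Finset.sum_pos (fun j _ => hall j) ⟨s, Finset.mem_univ _⟩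
    linarith
  funext s
  exact (Finset.sum_eq_zero_iff_of_nonpos (fun i _ => hnonpos i)).1 hs s (Finset.mem_univ _)

lemma aux_bound {S : Type} [Fintype S] [DecidableEq S] (P : Matrix S S ℝ)
    (hP : RowStochastic P) (hirr : IrreducibleMat P) :
    ∃ K : ℝ, 0 ≤ K ∧ ∀ v : S → ℝ, ∑ s, v s = 0 → ∀ c : ℝ, 0 ≤ c →
      (∀ s', |v s' - ∑ s, v s * P s s'| ≤ c) → ∀ s, |v s| ≤ K * c := by
  let T : (S → ℝ) →ₗ[ℝ] (S → ℝ) × ℝ :=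
    { toFun := fun v => (fun s' => v s' - ∑ s, v s * P s s', ∑ s, v s)
      map_add' := by
        intro x y
        ext
        · simp [add_mul, Finset.sum_add_distrib]; ring
        · simp [Finset.sum_add_distrib]
      map_smul' := by
        intro a x
        ext
        · simp [Finset.mul_sum, mul_sub, mul_assoc]
        · simp [Finset.mul_sum] }
  have hker : LinearMap.ker T = ⊥ := by
    rw [LinearMap.ker_eq_bot']
    intro v hv
    have h1 : (fun s' => v s' - ∑ s, v s * P s s') = 0 := congrArg Prod.fst hv
    have h2 : ∑ s, v s = 0 := congrArg Prod.snd hv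
    refine aux_kernel P hP hirr v (fun s' => ?_) h2
    have := congrFun h1 s'
    simp only [Pi.zero_apply] at this
    linarith
  obtain ⟨K, -, hK⟩ := T.exists_antilipschitzWith hker
  refine ⟨K, K.2, fun v hv c hc h s => ?_⟩
  have h3 : ‖v‖ ≤ K * ‖T v‖ := by
    have := hK.le_mul_dist v 0
    simpa [dist_zero_right] using this
  have h4 : ‖T v‖ ≤ c := by
    refine (Prod.norm_def (T v)).trans_le (max_le ?_ ?_)
    · exact (pi_norm_le_iff_of_nonneg hc).2 h
    · change ‖∑ s, v s‖ ≤ c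
      rw [hv]; simpa using hc
  calc |v s| ≤ ‖v‖ := norm_le_pi_norm v s
    _ ≤ K * ‖T v‖ := h3
    _ ≤ K * c := mul_le_mul_of_nonneg_left h4 K.2

lemma aux_dist_le {S : Type} [Fintype S] (μ : S → ℝ) (h0 : ∀ s, 0 ≤ μ s)
    (h1 : ∑ s, μ s = 1) (f : S → ℝ) : |∑ s, μ s * f s| ≤ ∑ s, |f s| := by
  refine (Finset.abs_sum_le_sum_abs _ _).trans (Finset.sum_le_sum fun s _ => ?_)
  rw [abs_mul, abs_of_nonneg (h0 s)]
  have : μ s ≤ 1 := h1 ▸ Finset.single_le_sum (fun i _ => h0 i) (Finset.mem_univ s)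
  exact mul_le_of_le_one_left (abs_nonneg _) this

lemma aux_policy {S : Type} [Fintype S] [DecidableEq S] (P Q : S → S → ℝ) (r rE : S → ℝ)
    (hP : RowStochastic (Matrix.of P)) (hirr : IrreducibleMat (Matrix.of P))
    (μ₀ : S → ℝ) (hinv : InvariantDist μ₀ (Matrix.of P)) :
    ∃ C : ℝ, 0 ≤ C ∧ ∀ ε : ℝ, 0 ≤ ε → ∀ μ : S → ℝ,
      InvariantDist μ (Matrix.of fun s s' => P s s' + ε * Q s s') →
      |(∑ s, μ s * (r s + ε * rE s)) - ∑ s, μ₀ s * r s| ≤ C * ε := by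
  obtain ⟨K, hK0, hK⟩ := aux_bound _ hP hirr
  set M : ℝ := ∑ s', ∑ s, |Q s s'| with hM
  have hM0 : 0 ≤ M := Finset.sum_nonneg fun _ _ => Finset.sum_nonneg fun _ _ => abs_nonneg _
  have hR0 : 0 ≤ ∑ s, |r s| := Finset.sum_nonneg fun _ _ => abs_nonneg _
  have hE0 : 0 ≤ ∑ s, |rE s| := Finset.sum_nonneg fun _ _ => abs_nonneg _
  refine ⟨K * M * (∑ s, |r s|) + ∑ s, |rE s|, by positivity, fun ε hε μ hμ => ?_⟩
  obtain ⟨hμ0, hμ1, hμ2⟩ := hμ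
  obtain ⟨-, hn1, hn2⟩ := hinv
  simp only [Matrix.of_apply] at hμ2 hn2 hK
  have hv : ∀ s, |μ s - μ₀ s| ≤ K * (ε * M) := by
    refine hK (fun s => μ s - μ₀ s) (by rw [Finset.sum_sub_distrib, hμ1, hn1, sub_self])
      (ε * M) (by positivity) (fun s' => ?_)
    have e : (μ s' - μ₀ s') - ∑ s, (μ s - μ₀ s) * P s s' = ε * ∑ s, μ s * Q s s' := by
      have h1 := hμ2 s'
      have h2 := hn2 s'
      have h3 : ∑ s, μ s * (P s s' + ε * Q s s')
          = ∑ s, μ s * P s s' + ε * ∑ s, μ s * Q s s' := by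
        rw [Finset.mul_sum, ← Finset.sum_add_distrib]
        exact Finset.sum_congr rfl fun _ _ => by ring
      simp only [sub_mul, Finset.sum_sub_distrib]
      linarith
    rw [e, abs_mul, abs_of_nonneg hε]
    refine mul_le_mul_of_nonneg_left ((aux_dist_le μ hμ0 hμ1 _).trans ?_) hε
    exact Finset.single_le_sum (f := fun s' => ∑ s, |Q s s'|)
      (fun _ _ => Finset.sum_nonneg fun _ _ => abs_nonneg _) (Finset.mem_univ s')
  have e : (∑ s, μ s * (r s + ε * rE s)) - ∑ s, μ₀ s * r s
      = ∑ s, (μ s - μ₀ s) * r s + ε * ∑ s, μ s * rE s := by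
    rw [Finset.mul_sum, ← Finset.sum_add_distrib, ← Finset.sum_sub_distrib]
    exact Finset.sum_congr rfl fun _ _ => by ring
  have b1 : |∑ s, (μ s - μ₀ s) * r s| ≤ K * (ε * M) * ∑ s, |r s| := by
    rw [Finset.mul_sum]
    refine (Finset.abs_sum_le_sum_abs _ _).trans (Finset.sum_le_sum fun s _ => ?_)
    rw [abs_mul]
    exact mul_le_mul_of_nonneg_right (hv s) (abs_nonneg _)
  have b2 : |ε * ∑ s, μ s * rE s| ≤ ε * ∑ s, |rE s| := by
    rw [abs_mul, abs_of_nonneg hε]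
    exact mul_le_mul_of_nonneg_left (aux_dist_le μ hμ0 hμ1 _) hε
  rw [e]
  refine (abs_add_le _ _).trans ((add_le_add b1 b2).trans (le_of_eq ?_))
  ring

lemma aux_pos (p q : ℝ) (hp : 0 ≤ p) (hq : p = 0 → 0 ≤ q) :
    ∃ δ > (0 : ℝ), ∀ ε : ℝ, 0 ≤ ε → ε < δ → 0 ≤ p + ε * q := by
  rcases hp.eq_or_lt with h | h
  · exact ⟨1, one_pos, fun ε h0 _ => add_nonneg hp (mul_nonneg h0 (hq h.symm))⟩
  · refine ⟨p / (|q| + 1), by positivity, fun ε h0 h1 => ?_⟩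
    rw [lt_div_iff₀ (by positivity)] at h1
    nlinarith [neg_abs_le q]

lemma aux_unif {ι : Type} [Finite ι] (p : ι → ℝ → Prop)
    (h : ∀ i, ∃ δ > (0 : ℝ), ∀ ε : ℝ, 0 ≤ ε → ε < δ → p i ε) :
    ∃ δ > (0 : ℝ), ∀ ε : ℝ, 0 ≤ ε → ε < δ → ∀ i, p i ε := by
  cases nonempty_fintype ι
  choose d hd h using h
  rcases isEmpty_or_nonempty ι with he | he
  · exact ⟨1, one_pos, fun _ _ _ i => he.elim i⟩
  · obtain ⟨j, hj⟩ := Finite.exists_min d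
    exact ⟨d j, hd j, fun ε h0 h1 i => h i ε h0 (h1.trans_le (hj i))⟩

/-- **Uniform (over stationary policies) first-order perturbation bound** for
the average reward in the ε-perturbed nearly separable MDP. -/
theorem nearly_separable_uniform_perturbation_bound
    {S A : Type} [Fintype S] [DecidableEq S] [Nonempty S] [Fintype A] [Nonempty A]
    (rS : S → ℝ) (rA : A → ℝ) (PA : A → S → ℝ)
    (hPA : ∀ a, (∀ s', 0 ≤ PA a s') ∧ ∑ s', PA a s' = 1)
    (rE : S → A → ℝ) (Q : S → A → S → ℝ)
    (hQ0 : ∀ s a, ∑ s', Q s a s' = 0)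
    (hQpos : ∀ s a s', PA a s' = 0 → 0 ≤ Q s a s')
    (hirr : ∀ π : S → A, IrreducibleMat (Matrix.of fun s s' => PA (π s) s'))
    (μ₀ : (S → A) → S → ℝ)
    (hinv : ∀ π : S → A, InvariantDist (μ₀ π) (Matrix.of fun s s' => PA (π s) s')) :
    ∃ C > (0 : ℝ), ∃ ε₀ > (0 : ℝ), ∀ ε : ℝ, 0 ≤ ε → ε < ε₀ → ∀ π : S → A,
      RowStochastic (Matrix.of fun s s' => PA (π s) s' + ε * Q s (π s) s') ∧
      ∀ μ : S → ℝ,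
        InvariantDist μ (Matrix.of fun s s' => PA (π s) s' + ε * Q s (π s) s') →
        |(∑ s, μ s * (rS s + rA (π s) + ε * rE s (π s))) -
            ∑ s, μ₀ π s * (rS s + rA (π s))| ≤ C * ε := by
  obtain ⟨δ, hδ, hpos⟩ := aux_unif (ι := S × A × S)
    (fun i ε => 0 ≤ PA i.2.1 i.2.2 + ε * Q i.1 i.2.1 i.2.2)
    (fun i => aux_pos _ _ ((hPA _).1 _) (hQpos _ _ _))
  have hC := fun π : S → A => aux_policy (fun s s' => PA (π s) s') (fun s s' => Q s (π s) s')
    (fun s => rS s + rA (π s)) (fun s => rE s (π s))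
    ⟨fun s s' => (hPA (π s)).1 s', fun s => (hPA (π s)).2⟩ (hirr π) (μ₀ π) (hinv π)
  choose C hC0 hC using hC
  refine ⟨∑ π, C π + 1, add_pos_of_nonneg_of_pos (Finset.sum_nonneg fun π _ => hC0 π) one_pos,
    δ, hδ, fun ε h0 h1 π => ⟨⟨fun s s' => hpos ε h0 h1 (s, π s, s'), fun s => ?_⟩,
    fun μ hμ => (hC π ε h0 μ hμ).trans (mul_le_mul_of_nonneg_right ?_ h0)⟩⟩
  · simp only [Matrix.of_apply]
    rw [Finset.sum_add_distrib, ← Finset.mul_sum, hQ0, (hPA (π s)).2, mul_zero, add_zero]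
  · have := Finset.single_le_sum (fun π _ => hC0 π) (Finset.mem_univ π)
    linarith
end
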